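/- arXiv:1802.03196 — 2 statements merged into one kernel-verified Lean document; each statement's English description precedes it below -/
import Mathlib

section
/- Let Ω be a differential 2-form of rank 4 on a smooth 4-dimensional manifold M, and let Z_Ω be the vector field determined by i_{Z_Ω}Ω = ω_Ω. Then: (i) ω_Ω ∧ dΩ = 0; (ii) dω_Ω ∧ Ω = 0; (iii) i_{Z_Ω} dΩ = 0; (iv) L_{Z_Ω} Ω = dω_Ω (L denoting the Lie derivative). -/
/-!  Coordinate formalization of differential forms in four variables,
     following "The equivalence problem of differential 2-forms in 4 variables". -/

open Real Filter

/-- Points of `ℝ⁴`; the coordinates `x¹, x², x³, x⁴` of the paper are `x 0, x 1, x 2, x 3`. -/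
abbrev Pt := Fin 4 → ℝ

/-- Partial derivative `∂f/∂xⁱ`. -/
noncomputable def pd (i : Fin 4) (f : Pt → ℝ) (x : Pt) : ℝ :=
  fderiv ℝ f x (Pi.single i 1)

/-- Second partial derivative `∂²f/∂xⁱ∂xʲ`. -/
noncomputable def pd2 (i j : Fin 4) (f : Pt → ℝ) (x : Pt) : ℝ :=
  pd i (fun y => pd j f y) x

/-- Differential forms of degree 0,1,2,3,4 on `ℝ⁴`, given by their (skew-symmetric)
    coordinate components, and vector fields. -/
abbrev Form0 := Pt → ℝ
abbrev Form1 := Pt → Fin 4 → ℝ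
abbrev Form2 := Pt → Fin 4 → Fin 4 → ℝ
abbrev Form3 := Pt → Fin 4 → Fin 4 → Fin 4 → ℝ
abbrev Form4 := Pt → Fin 4 → Fin 4 → Fin 4 → Fin 4 → ℝ
abbrev Vec := Pt → Fin 4 → ℝ

/-- A 2-form has skew-symmetric components. -/
def Alt2 (B : Form2) : Prop := ∀ x i j, B x i j = - B x j i

/-- Exterior derivative of a function. -/
noncomputable def d0 (f : Form0) : Form1 := fun x i => pd i f x

/-- Exterior derivative of a 1-form. -/
noncomputable def d1 (ω : Form1) : Form2 := fun x i j =>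
  pd i (fun y => ω y j) x - pd j (fun y => ω y i) x

/-- Exterior derivative of a 2-form. -/
noncomputable def d2 (B : Form2) : Form3 := fun x i j k =>
  pd i (fun y => B y j k) x - pd j (fun y => B y i k) x + pd k (fun y => B y i j) x

/-- Wedge product of two 1-forms. -/
def w11 (ω η : Form1) : Form2 := fun x i j => ω x i * η x j - ω x j * η x i

/-- Wedge product of a 1-form and a 2-form. -/
def w12 (ω : Form1) (B : Form2) : Form3 := fun x i j k =>
  ω x i * B x j k - ω x j * B x i k + ω x k * B x i j

/-- Wedge product of a 1-form and a 3-form. -/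
def w13 (ω : Form1) (C : Form3) : Form4 := fun x i j k l =>
  ω x i * C x j k l - ω x j * C x i k l + ω x k * C x i j l - ω x l * C x i j k

/-- Wedge product of two 2-forms. -/
def w22 (A B : Form2) : Form4 := fun x i j k l =>
  A x i j * B x k l - A x i k * B x j l + A x i l * B x j k
    + A x j k * B x i l - A x j l * B x i k + A x k l * B x i j

/-- A 2-form is of rank 4 when `Ω ∧ Ω` vanishes nowhere. -/
def Rank4 (B : Form2) : Prop := ∀ x, w22 B B x ≠ 0

/-- Interior products `i_X`. -/
def i1 (X : Vec) (ω : Form1) : Form0 := fun x => ∑ i, X x i * ω x i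
def i2 (X : Vec) (B : Form2) : Form1 := fun x j => ∑ i, X x i * B x i j
def i3 (X : Vec) (C : Form3) : Form2 := fun x j k => ∑ i, X x i * C x i j k
def i4 (X : Vec) (D : Form4) : Form3 := fun x j k l => ∑ i, X x i * D x i j k l

/-- Evaluation `B(X,Y)` of a 2-form on two vector fields. -/
def ev2 (B : Form2) (X Y : Vec) : Form0 := fun x => ∑ i, ∑ j, X x i * Y x j * B x i j

/-- Evaluation `D(X,Y,Z,W)` of a 4-form on four vector fields. -/
def ev4 (D : Form4) (X Y Z W : Vec) : Form0 := fun x =>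
  ∑ i, ∑ j, ∑ k, ∑ l, X x i * Y x j * Z x k * W x l * D x i j k l

/-- Lie derivative of a 1-form (Cartan's magic formula). -/
noncomputable def lie1 (X : Vec) (ω : Form1) : Form1 := fun x i =>
  d0 (i1 X ω) x i + i2 X (d1 ω) x i

/-- Lie derivative of a 2-form (Cartan's magic formula). -/
noncomputable def lie2 (X : Vec) (B : Form2) : Form2 := fun x i j =>
  d1 (i2 X B) x i j + i3 X (d2 B) x i j

/-- Lie bracket of two vector fields. -/
noncomputable def bracket (X Y : Vec) : Vec := fun x i =>
  ∑ j, (X x j * pd j (fun y => Y y i) x - Y x j * pd j (fun y => X y i) x)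

/-- Derivative `X(f)` of a function along a vector field. -/
noncomputable def dirDeriv (X : Vec) (f : Form0) : Form0 := fun x => ∑ j, X x j * pd j f x

/-- Pullback of a 1-form under a smooth map. -/
noncomputable def pull1 (φ : Pt → Pt) (ω : Form1) : Form1 := fun x i =>
  ∑ a, ω (φ x) a * pd i (fun y => φ y a) x

/-- Pullback of a 2-form under a smooth map. -/
noncomputable def pull2 (φ : Pt → Pt) (B : Form2) : Form2 := fun x i j =>
  ∑ a, ∑ b, B (φ x) a b * pd i (fun y => φ y a) x * pd j (fun y => φ y b) x

/-- A pair of mutually inverse smooth maps: a diffeomorphism of `ℝ⁴` (with inverse). -/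
def IsDiffeo (φ ψ : Pt → Pt) : Prop :=
  ContDiff ℝ (⊤ : ℕ∞) φ ∧ ContDiff ℝ (⊤ : ℕ∞) ψ ∧ (∀ x, ψ (φ x) = x) ∧ (∀ x, φ (ψ x) = x)

/-- The covector with components `c` as a linear functional on the tangent space `ℝ⁴`. -/
noncomputable def covec (c : Fin 4 → ℝ) : Pt →ₗ[ℝ] ℝ :=
  ∑ i, c i • (LinearMap.proj i : Pt →ₗ[ℝ] ℝ)

/-- The class of a 1-form `ω` at `x`: the codimension of the space of tangent vectors `v`
    with `i_v ω = 0` and `i_v (dω) = 0`. -/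
noncomputable def classAt (ω : Form1) (x : Pt) : ℕ :=
  4 - Module.finrank ℝ
    ↥(LinearMap.ker (covec (ω x)) ⊓ ⨅ j, LinearMap.ker (covec (fun i => d1 ω x i j)))

/-- Components of the constant 2-form `dxᵃ ∧ dxᵇ`. -/
def dxw (a b : Fin 4) : Fin 4 → Fin 4 → ℝ := fun i j =>
  (if i = a ∧ j = b then (1:ℝ) else 0) - (if i = b ∧ j = a then (1:ℝ) else 0)

/-- A germ of 2-form (with associated 1-form `ω = ω_Ω`) is of type `t` at `x₀`:
    `ω` is nonsingular at `x₀` and of constant class `t` near `x₀`. -/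
def IsTypeAt (ω : Form1) (t : ℕ) (x₀ : Pt) : Prop :=
  ω x₀ ≠ 0 ∧ ∀ᶠ x in nhds x₀, classAt ω x = t

theorem two_le_aux' : (2 : WithTop ℕ∞) ≤ ((⊤ : ℕ∞) : WithTop ℕ∞) := by
  have h : ((2 : ℕ∞) : WithTop ℕ∞) ≤ ((⊤ : ℕ∞) : WithTop ℕ∞) := WithTop.coe_le_coe.2 le_top
  exact h

theorem two_le_aux : (1 + 1 : WithTop ℕ∞) ≤ ((⊤ : ℕ∞) : WithTop ℕ∞) := by
  rw [one_add_one_eq_two]; exact two_le_aux'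

theorem pd_symm_aux (f : Pt → ℝ) (hf : ContDiff ℝ (⊤ : ℕ∞) f) (i j : Fin 4) (x : Pt) :
    pd i (pd j f) x = pd j (pd i f) x := by
  have hd : DifferentiableAt ℝ (fderiv ℝ f) x :=
    (hf.fderiv_right (m := 1) two_le_aux).differentiable (by norm_num) x
  have key : ∀ a b : Fin 4, pd a (pd b f) x
      = fderiv ℝ (fderiv ℝ f) x (Pi.single a 1) (Pi.single b 1) := by
    intro a b
    have : HasFDerivAt (fun y => fderiv ℝ f y (Pi.single b 1))
        ((fderiv ℝ (fderiv ℝ f) x).flip (Pi.single b 1)) x := by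
      have h2 := hd.hasFDerivAt.clm_apply (hasFDerivAt_const (Pi.single b 1 : Pt) x)
      simpa using h2
    show fderiv ℝ (fun y => fderiv ℝ f y (Pi.single b 1)) x (Pi.single a 1) = _
    rw [this.fderiv]; rfl
  rw [key, key]
  have hs : IsSymmSndFDerivAt ℝ f x :=
    hf.contDiffAt.isSymmSndFDerivAt (by simpa using two_le_aux')
  exact hs _ _

theorem pd_mul_aux (f g : Pt → ℝ) (i : Fin 4) (x : Pt) (hf : DifferentiableAt ℝ f x)
    (hg : DifferentiableAt ℝ g x) :
    pd i (fun y => f y * g y) x = f x * pd i g x + g x * pd i f x := by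
  unfold pd
  rw [fderiv_fun_mul hf hg]; simp

theorem pd_comb_aux (f g h : Pt → ℝ) (i : Fin 4) (x : Pt) (hf : DifferentiableAt ℝ f x)
    (hg : DifferentiableAt ℝ g x) (hh : DifferentiableAt ℝ h x) :
    pd i (fun y => f y - g y + h y) x = pd i f x - pd i g x + pd i h x := by
  unfold pd
  rw [fderiv_fun_add (hf.fun_sub hg) hh, fderiv_fun_sub hf hg]; simp

theorem pd_diff_aux (f : Pt → ℝ) (hf : ContDiff ℝ (⊤ : ℕ∞) f) (i : Fin 4) (x : Pt) :
    DifferentiableAt ℝ (pd i f) x := by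
  have hd : DifferentiableAt ℝ (fderiv ℝ f) x :=
    (hf.fderiv_right (m := 1) two_le_aux).differentiable (by norm_num) x
  exact hd.clm_apply (differentiableAt_const _)

/-- Proposition `ZandT`, items (i)–(iv). For a rank-4 2-form `Ω` with
`ω_Ω ∧ Ω = dΩ` and `i_{Z_Ω}Ω = ω_Ω`:
(i) `ω_Ω ∧ dΩ = 0`; (ii) `dω_Ω ∧ Ω = 0`; (iii) `i_{Z_Ω} dΩ = 0`; (iv) `L_{Z_Ω} Ω = dω_Ω`. -/
theorem ZandT_basic (Ω : Form2) (hΩs : ContDiff ℝ (⊤ : ℕ∞) Ω) (hΩa : Alt2 Ω)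
    (hΩr : Rank4 Ω)
    (ω : Form1) (hωs : ContDiff ℝ (⊤ : ℕ∞) ω) (hω : ∀ x, w12 ω Ω x = d2 Ω x)
    (Z : Vec) (hZs : ContDiff ℝ (⊤ : ℕ∞) Z) (hZ : ∀ x, i2 Z Ω x = ω x) :
    (∀ x, w13 ω (d2 Ω) x = 0) ∧
    (∀ x, w22 (d1 ω) Ω x = 0) ∧
    (∀ x, i3 Z (d2 Ω) x = 0) ∧
    (∀ x, lie2 Z Ω x = d1 ω x) := by
  have cΩ : ∀ j k, ContDiff ℝ (⊤ : ℕ∞) (fun y => Ω y j k) := fun j k =>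
    contDiff_pi.1 (contDiff_pi.1 hΩs j) k
  have cω : ∀ j, ContDiff ℝ (⊤ : ℕ∞) (fun y => ω y j) := fun j => contDiff_pi.1 hωs j
  have dΩ : ∀ j k x, DifferentiableAt ℝ (fun y => Ω y j k) x := fun j k x =>
    (cΩ j k).differentiable (by simp) x
  have dω : ∀ j x, DifferentiableAt ℝ (fun y => ω y j) x := fun j x =>
    (cω j).differentiable (by simp) x
  have hC : ∀ x i j k, d2 Ω x i j k = ω x i * Ω x j k - ω x j * Ω x i k + ω x k * Ω x i j := by
    intro x i j k
    rw [← hω x]; rfl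
  have h1 : ∀ x, w13 ω (d2 Ω) x = 0 := by
    intro x
    funext i j k l
    simp only [w13, hC, Pi.zero_apply]
    ring
  have h3 : ∀ x, i3 Z (d2 Ω) x = 0 := by
    intro x
    funext j k
    have hz : ∀ j, ω x j = ∑ i, Z x i * Ω x i j := fun j => by rw [← hZ x]; rfl
    have hzz : ∑ i, Z x i * ω x i = 0 := by
      have e : ∑ i, Z x i * ω x i = - ∑ i, Z x i * ω x i := by
        calc ∑ i, Z x i * ω x i = ∑ i, ∑ m, Z x i * (Z x m * Ω x m i) := by
              simp only [hz, Finset.mul_sum]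
          _ = ∑ m, ∑ i, Z x i * (Z x m * Ω x m i) := Finset.sum_comm
          _ = ∑ m, ∑ i, -(Z x m * (Z x i * Ω x i m)) := by
              refine Finset.sum_congr rfl fun m _ => Finset.sum_congr rfl fun i _ => ?_
              rw [hΩa x m i]; ring
          _ = - ∑ i, Z x i * ω x i := by
              simp only [hz, Finset.mul_sum, Finset.sum_neg_distrib]
      linarith
    have e : ∑ i, Z x i * (ω x i * Ω x j k - ω x j * Ω x i k + ω x k * Ω x i j)
        = (∑ i, Z x i * ω x i) * Ω x j k - ω x j * (∑ i, Z x i * Ω x i k)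
          + ω x k * (∑ i, Z x i * Ω x i j) := by
      simp only [Fin.sum_univ_four]; ring
    simp only [i3, hC, Pi.zero_apply]
    rw [e, hzz, ← hz, ← hz]; ring
  refine ⟨h1, ?_, h3, ?_⟩
  · intro x
    funext i j k l
    have A : ∀ a i j k, pd a (fun y => d2 Ω y i j k) x
        = pd a (pd i (fun y => Ω y j k)) x - pd a (pd j (fun y => Ω y i k)) x
          + pd a (pd k (fun y => Ω y i j)) x := fun a i j k =>
      pd_comb_aux _ _ _ a x (pd_diff_aux _ (cΩ j k) i x) (pd_diff_aux _ (cΩ i k) j x)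
        (pd_diff_aux _ (cΩ i j) k x)
    have B : ∀ a i j k, pd a (fun y => d2 Ω y i j k) x
        = (ω x i * pd a (fun y => Ω y j k) x + Ω x j k * pd a (fun y => ω y i) x)
          - (ω x j * pd a (fun y => Ω y i k) x + Ω x i k * pd a (fun y => ω y j) x)
          + (ω x k * pd a (fun y => Ω y i j) x + Ω x i j * pd a (fun y => ω y k) x) := by
      intro a i j k
      simp only [hC]
      rw [pd_comb_aux _ _ _ a x ((dω i x).fun_mul (dΩ j k x)) ((dω j x).fun_mul (dΩ i k x))
        ((dω k x).fun_mul (dΩ i j x)), pd_mul_aux _ _ a x (dω i x) (dΩ j k x),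
        pd_mul_aux _ _ a x (dω j x) (dΩ i k x), pd_mul_aux _ _ a x (dω k x) (dΩ i j x)]
    have S : ∀ a b p q, pd a (pd b (fun y => Ω y p q)) x = pd b (pd a (fun y => Ω y p q)) x :=
      fun a b p q => pd_symm_aux _ (cΩ p q) a b x
    have D : pd i (fun y => d2 Ω y j k l) x - pd j (fun y => d2 Ω y i k l) x
        + pd k (fun y => d2 Ω y i j l) x - pd l (fun y => d2 Ω y i j k) x = 0 := by
      simp only [A]
      linarith [S i j k l, S i k j l, S i l j k, S j k i l, S j l i k, S k l i j]
    simp only [B] at D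
    have W := congrFun (congrFun (congrFun (congrFun (h1 x) i) j) k) l
    simp only [w13, d2, Pi.zero_apply] at W
    simp only [w22, d1, Pi.zero_apply]
    linear_combination D + W
  · intro x
    funext i j
    have e : i2 Z Ω = ω := funext hZ
    simp only [lie2, e, h3 x, Pi.zero_apply, add_zero]
end

section
/- Let Ω be a differential 2-form of rank 4 on a smooth 4-dimensional manifold M, with associated 1-forms ω_Ω and φ_Ω, vector fields Z_Ω, T_Ω determined by i_{Z_Ω}Ω = ω_Ω and i_{T_Ω}Ω = φ_Ω, and invariant function I(Ω). Then: (v) φ_Ω ∧ dΩ = 0; (vi) dφ_Ω ∧ Ω = dω_Ω ∧ dω_Ω; (vii) φ_Ω = −L_{Z_Ω} ω_Ω; (viii) φ_Ω ∧ dω_Ω = −I(Ω)·ω_Ω∧Ω; (ix) i_{T_Ω} dω_Ω = I(Ω)·ω_Ω. -/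
/-!  Coordinate formalization of differential forms in four variables,
     following "The equivalence problem of differential 2-forms in 4 variables". -/

open Real Filter

/-- Exterior derivative of a 3-form (helper). -/
noncomputable def hd3 (C : Form3) : Form4 := fun x i j k l =>
  pd i (fun y => C y j k l) x - pd j (fun y => C y i k l) x
    + pd k (fun y => C y i j l) x - pd l (fun y => C y i j k) x

lemma pd_add' {f g : Pt → ℝ} {x : Pt} (i : Fin 4) (hf : DifferentiableAt ℝ f x)
    (hg : DifferentiableAt ℝ g x) : pd i (fun y => f y + g y) x = pd i f x + pd i g x := by
  unfold pd; rw [fderiv_fun_add hf hg]; rfl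

lemma pd_sub' {f g : Pt → ℝ} {x : Pt} (i : Fin 4) (hf : DifferentiableAt ℝ f x)
    (hg : DifferentiableAt ℝ g x) : pd i (fun y => f y - g y) x = pd i f x - pd i g x := by
  unfold pd; rw [fderiv_fun_sub hf hg]; rfl

lemma pd_mul' {f g : Pt → ℝ} {x : Pt} (i : Fin 4) (hf : DifferentiableAt ℝ f x)
    (hg : DifferentiableAt ℝ g x) :
    pd i (fun y => f y * g y) x = f x * pd i g x + g x * pd i f x := by
  unfold pd; rw [fderiv_fun_mul hf hg]; simp

lemma pd_smooth {f : Pt → ℝ} (i : Fin 4) (hf : ContDiff ℝ (⊤ : ℕ∞) f) :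
    ContDiff ℝ (⊤ : ℕ∞) (fun y => pd i f y) := by
  unfold pd
  exact (hf.fderiv_right (m := (⊤ : ℕ∞)) (by simp)).clm_apply contDiff_const

lemma sm_diff {f : Pt → ℝ} (hf : ContDiff ℝ (⊤ : ℕ∞) f) (x : Pt) : DifferentiableAt ℝ f x :=
  (hf.differentiable (by simp)) x

lemma pd_comm {f : Pt → ℝ} (hf : ContDiff ℝ (⊤ : ℕ∞) f) (i j : Fin 4) (x : Pt) :
    pd i (fun y => pd j f y) x = pd j (fun y => pd i f y) x := by
  have hd : DifferentiableAt ℝ (fderiv ℝ f) x :=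
    ((hf.fderiv_right (m := (⊤ : ℕ∞)) (by simp)).differentiable (by simp)) x
  have hs : IsSymmSndFDerivAt ℝ f x :=
    hf.contDiffAt.isSymmSndFDerivAt (by rw [minSmoothness_of_isRCLikeNormedField]; exact WithTop.coe_le_coe.2 (le_top : (2 : ℕ∞) ≤ ⊤))
  have key : ∀ a b : Fin 4, pd a (fun y => pd b f y) x
      = fderiv ℝ (fderiv ℝ f) x (Pi.single a 1) (Pi.single b 1) := by
    intro a b
    unfold pd
    rw [fderiv_clm_apply hd (differentiableAt_const _)]
    simp
  rw [key, key]
  exact hs _ _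

lemma comp1 {ω : Form1} (h : ContDiff ℝ (⊤ : ℕ∞) ω) (i : Fin 4) :
    ContDiff ℝ (⊤ : ℕ∞) (fun y => ω y i) := contDiff_pi.1 h i

lemma comp2 {B : Form2} (h : ContDiff ℝ (⊤ : ℕ∞) B) (i j : Fin 4) :
    ContDiff ℝ (⊤ : ℕ∞) (fun y => B y i j) := contDiff_pi.1 (contDiff_pi.1 h i) j

lemma d1_smooth {ω : Form1} (h : ContDiff ℝ (⊤ : ℕ∞) ω) : ContDiff ℝ (⊤ : ℕ∞) (d1 ω) := by
  refine contDiff_pi.2 fun i => contDiff_pi.2 fun j => ?_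
  exact (pd_smooth i (comp1 h j)).sub (pd_smooth j (comp1 h i))

lemma hd3_w12 {α : Form1} {B : Form2} (hα : ContDiff ℝ (⊤ : ℕ∞) α) (hB : ContDiff ℝ (⊤ : ℕ∞) B)
    (x : Pt) (i j k l : Fin 4) :
    hd3 (w12 α B) x i j k l = w22 (d1 α) B x i j k l - w13 α (d2 B) x i j k l := by
  have h1 : ∀ a, DifferentiableAt ℝ (fun y => α y a) x := fun a => sm_diff (comp1 hα a) x
  have h2 : ∀ a b, DifferentiableAt ℝ (fun y => B y a b) x := fun a b => sm_diff (comp2 hB a b) x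
  have key : ∀ m a b c, pd m (fun y => w12 α B y a b c) x
      = (α x a * pd m (fun y => B y b c) x + B x b c * pd m (fun y => α y a) x)
      - (α x b * pd m (fun y => B y a c) x + B x a c * pd m (fun y => α y b) x)
      + (α x c * pd m (fun y => B y a b) x + B x a b * pd m (fun y => α y c) x) := by
    intro m a b c
    unfold w12
    rw [pd_add' m (((h1 a).fun_mul (h2 b c)).fun_sub ((h1 b).fun_mul (h2 a c))) ((h1 c).fun_mul (h2 a b)),
      pd_sub' m ((h1 a).fun_mul (h2 b c)) ((h1 b).fun_mul (h2 a c)),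
      pd_mul' m (h1 a) (h2 b c), pd_mul' m (h1 b) (h2 a c), pd_mul' m (h1 c) (h2 a b)]
  unfold hd3
  simp only [key, w22, w13, d1, d2]
  ring

lemma hd3_d2 {B : Form2} (hB : ContDiff ℝ (⊤ : ℕ∞) B) (x : Pt) (i j k l : Fin 4) :
    hd3 (d2 B) x i j k l = 0 := by
  have h2 : ∀ m a b, DifferentiableAt ℝ (fun y => pd m (fun z => B z a b) y) x :=
    fun m a b => sm_diff (pd_smooth m (comp2 hB a b)) x
  have key : ∀ m a b c, pd m (fun y => d2 B y a b c) x
      = pd m (fun y => pd a (fun z => B z b c) y) x - pd m (fun y => pd b (fun z => B z a c) y) x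
        + pd m (fun y => pd c (fun z => B z a b) y) x := by
    intro m a b c
    unfold d2
    rw [pd_add' m ((h2 a b c).fun_sub (h2 b a c)) (h2 c a b), pd_sub' m (h2 a b c) (h2 b a c)]
  unfold hd3
  simp only [key]
  rw [pd_comm (comp2 hB k l) i j, pd_comm (comp2 hB j l) i k, pd_comm (comp2 hB j k) i l,
    pd_comm (comp2 hB i l) j k, pd_comm (comp2 hB i k) j l, pd_comm (comp2 hB i j) k l]
  ring

lemma d2_d1 {ω : Form1} (h : ContDiff ℝ (⊤ : ℕ∞) ω) (x : Pt) (i j k : Fin 4) :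
    d2 (d1 ω) x i j k = 0 := by
  have h2 : ∀ m a, DifferentiableAt ℝ (fun y => pd m (fun z => ω z a) y) x :=
    fun m a => sm_diff (pd_smooth m (comp1 h a)) x
  have key : ∀ m a b, pd m (fun y => d1 ω y a b) x
      = pd m (fun y => pd a (fun z => ω z b) y) x - pd m (fun y => pd b (fun z => ω z a) y) x := by
    intro m a b
    unfold d1
    rw [pd_sub' m (h2 a b) (h2 b a)]
  unfold d2
  simp only [key]
  rw [pd_comm (comp1 h k) i j, pd_comm (comp1 h j) i k, pd_comm (comp1 h i) j k]
  ring

lemma int_w22 (X : Vec) (A B : Form2) (x : Pt) (j k l : Fin 4) :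
    w12 (i2 X A) B x j k l + w12 (i2 X B) A x j k l = ∑ i, X x i * w22 A B x i j k l := by
  simp only [w12, i2, w22, Fin.sum_univ_four]
  ring

lemma pf_ne {Ω : Form2} (ha : Alt2 Ω) (hr : Rank4 Ω) (x : Pt) :
    Ω x 0 1 * Ω x 2 3 - Ω x 0 2 * Ω x 1 3 + Ω x 0 3 * Ω x 1 2 ≠ 0 := by
  intro h
  apply hr x
  have d : ∀ i, Ω x i i = 0 := fun i => by linarith [ha x i i]
  have e1 := ha x 1 0
  have e2 := ha x 2 0
  have e3 := ha x 3 0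
  have e4 := ha x 2 1
  have e5 := ha x 3 1
  have e6 := ha x 3 2
  funext i j k l
  fin_cases i <;> fin_cases j <;> fin_cases k <;> fin_cases l <;>
    simp only [w22, Fin.zero_eta, Fin.mk_one, Fin.reduceFinMk, Pi.zero_apply, d, e1, e2, e3, e4,
      e5, e6] <;> first | ring1 | linear_combination 2 * h | linear_combination (-2) * h

lemma w12_inj {Ω : Form2} (ha : Alt2 Ω) (hr : Rank4 Ω) (x : Pt) (α β : Form1)
    (h : ∀ i j k, w12 α Ω x i j k = w12 β Ω x i j k) (i : Fin 4) : α x i = β x i := by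
  have hp := pf_ne ha hr x
  have e1 := ha x 1 0
  have e2 := ha x 2 0
  have e3 := ha x 3 0
  have e4 := ha x 2 1
  have e5 := ha x 3 1
  have e6 := ha x 3 2
  have h1 := h 0 1 2
  have h2 := h 0 1 3
  have h3 := h 0 2 3
  have h4 := h 1 2 3
  simp only [w12] at h1 h2 h3 h4
  apply mul_right_cancel₀ hp
  fin_cases i <;> simp only [Fin.zero_eta, Fin.mk_one, Fin.reduceFinMk]
  · linear_combination Ω x 0 3 * h1 - Ω x 0 2 * h2 + Ω x 0 1 * h3
  · linear_combination Ω x 1 3 * h1 - Ω x 1 2 * h2 + Ω x 0 1 * h4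
  · linear_combination Ω x 2 3 * h1 - Ω x 1 2 * h3 + Ω x 0 2 * h4
  · linear_combination Ω x 2 3 * h2 - Ω x 1 3 * h3 + Ω x 0 3 * h4

/-- Proposition `ZandT`, items (v)–(ix). For a rank-4 2-form `Ω` with
associated `ω_Ω`, `φ_Ω`, `Z_Ω`, `T_Ω` and invariant `I(Ω)`:
(v) `φ_Ω ∧ dΩ = 0`; (vi) `dφ_Ω ∧ Ω = dω_Ω ∧ dω_Ω`; (vii) `φ_Ω = −L_{Z_Ω}ω_Ω`;
(viii) `φ_Ω ∧ dω_Ω = −I(Ω)·ω_Ω∧Ω`; (ix) `i_{T_Ω} dω_Ω = I(Ω)·ω_Ω`. -/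
theorem ZandT_varphi (Ω : Form2) (hΩs : ContDiff ℝ (⊤ : ℕ∞) Ω) (hΩa : Alt2 Ω)
    (hΩr : Rank4 Ω)
    (ω : Form1) (hωs : ContDiff ℝ (⊤ : ℕ∞) ω) (hω : ∀ x, w12 ω Ω x = d2 Ω x)
    (θ : Form1) (hθs : ContDiff ℝ (⊤ : ℕ∞) θ) (hθ : ∀ x, w12 θ Ω x = w12 ω (d1 ω) x)
    (Z : Vec) (hZs : ContDiff ℝ (⊤ : ℕ∞) Z) (hZ : ∀ x, i2 Z Ω x = ω x)
    (T : Vec) (hTs : ContDiff ℝ (⊤ : ℕ∞) T) (hT : ∀ x, i2 T Ω x = θ x)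
    (I : Form0) (hI : ∀ x i j k l, I x * w22 Ω Ω x i j k l = w22 (d1 ω) (d1 ω) x i j k l) :
    (∀ x, w13 θ (d2 Ω) x = 0) ∧
    (∀ x, w22 (d1 θ) Ω x = w22 (d1 ω) (d1 ω) x) ∧
    (∀ x i, θ x i = -(lie1 Z ω x i)) ∧
    (∀ x i j k, w12 θ (d1 ω) x i j k = -(I x * w12 ω Ω x i j k)) ∧
    (∀ x i, i2 T (d1 ω) x i = I x * ω x i) := by
  have hωf : w12 ω Ω = d2 Ω := funext hω
  have hθf : w12 θ Ω = w12 ω (d1 ω) := funext hθ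
  have hZf : i2 Z Ω = ω := funext hZ
  have hTf : i2 T Ω = θ := funext hT
  have hDΩ : ∀ x i j k l, w22 (d1 ω) Ω x i j k l = 0 := by
    intro x i j k l
    have h := hd3_w12 hωs hΩs x i j k l
    rw [hωf, hd3_d2 hΩs, ← hωf] at h
    have h0 : w13 ω (w12 ω Ω) x i j k l = 0 := by simp only [w13, w12]; ring
    linarith
  have hv : ∀ x i j k l, w13 θ (d2 Ω) x i j k l = 0 := by
    intro x i j k l
    have h0 : w13 θ (w12 ω Ω) x i j k l = - w13 ω (w12 θ Ω) x i j k l := by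
      simp only [w13, w12]; ring
    rw [← hωf, h0, hθf]
    simp only [w13, w12]; ring
  have hvi : ∀ x i j k l, w22 (d1 θ) Ω x i j k l = w22 (d1 ω) (d1 ω) x i j k l := by
    intro x i j k l
    have h := hd3_w12 hθs hΩs x i j k l
    have h' := hd3_w12 hωs (d1_smooth hωs) x i j k l
    rw [hθf, h', hv] at h
    have h0 : w13 ω (d2 (d1 ω)) x i j k l = 0 := by
      simp only [w13, d2_d1 hωs]; ring
    linarith
  have hZω : i1 Z ω = fun _ => 0 := by
    funext x
    have d : ∀ i, Ω x i i = 0 := fun i => by linarith [hΩa x i i]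
    rw [← hZf]
    simp only [i1, i2, Fin.sum_univ_four, d, hΩa x 1 0, hΩa x 2 0, hΩa x 3 0, hΩa x 2 1,
      hΩa x 3 1, hΩa x 3 2]
    ring
  have hvii' : ∀ x i, θ x i = -(i2 Z (d1 ω) x i) := by
    intro x i
    refine w12_inj hΩa hΩr x θ (fun x i => -(i2 Z (d1 ω) x i)) ?_ i
    intro j k l
    have h := int_w22 Z (d1 ω) Ω x j k l
    simp only [hDΩ, mul_zero, Finset.sum_const_zero, hZf] at h
    rw [hθf]
    simp only [w12] at h ⊢
    linarith
  have hviii : ∀ x i j k, w12 θ (d1 ω) x i j k = -(I x * w12 ω Ω x i j k) := by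
    intro x j k l
    have h1 := int_w22 Z (d1 ω) (d1 ω) x j k l
    have h2 := int_w22 Z Ω Ω x j k l
    simp only [← hI] at h1
    rw [hZf] at h2
    simp only [w12] at h1 h2 ⊢
    simp only [hvii', Fin.sum_univ_four] at h1 h2 ⊢
    linear_combination (-1 / 2) * h1 + (I x / 2) * h2
  refine ⟨fun x => ?_, fun x => ?_, fun x i => ?_, hviii, fun x i => ?_⟩
  · funext i j k l; exact hv x i j k l
  · funext i j k l; exact hvi x i j k l
  · rw [hvii' x i]
    simp only [lie1, hZω, d0, pd]
    simp
  · refine w12_inj hΩa hΩr x (i2 T (d1 ω)) (fun x i => I x * ω x i) ?_ i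
    intro j k l
    have h := int_w22 T (d1 ω) Ω x j k l
    simp only [hDΩ, mul_zero, Finset.sum_const_zero, hTf] at h
    have h' := hviii x j k l
    simp only [w12] at h h' ⊢
    linarith
end
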